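/- Let p ≥ 2, α = p−1 and θ ≥ 0, and fix σ with 0 < σ < μ_{α,θ}. Then limsup_{s→0⁺} [ (1 − (s/σ)^{p−1}) / (s/σ)^{p−1} ] · TMSC(s,α,θ) equals 0 if k₀ > p−1, and is at most σ^{k₀}/k₀! if k₀ = p−1. -/

import Mathlib

open MeasureTheory Real Filter ENNReal

/-- The fractional-dimension spherical volume constant `ω_θ = 2π^((θ+1)/2)/Γ((θ+1)/2)`. -/
noncomputable def omegaW (θ : ℝ) : ℝ := 2 * Real.pi ^ ((θ + 1) / 2) / Real.Gamma ((θ + 1) / 2)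

/-- Weighted integral `∫₀^∞ f dλ_θ = ω_θ ∫₀^∞ f(r) r^θ dr` (for nonnegative integrands,
valued in `ℝ≥0∞`). -/
noncomputable def wInt (θ : ℝ) (f : ℝ → ℝ) : ℝ≥0∞ :=
  ENNReal.ofReal (omegaW θ) *
    ∫⁻ r in Set.Ioi (0 : ℝ), ENNReal.ofReal (f r) * ENNReal.ofReal (r ^ θ)

/-- The weighted Lebesgue norm `‖u‖_{L^q_θ}` (valued in `ℝ≥0∞`). -/
noncomputable def wNorm (θ q : ℝ) (u : ℝ → ℝ) : ℝ≥0∞ :=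
  (wInt θ fun r => |u r| ^ q) ^ (1 / q)

/-- Membership in the weighted Sobolev space `X = X^{1,p}_∞(α,θ)`:
`u` is locally absolutely continuous on `(0,∞)` with a.e. derivative `u'`
(expressed through the fundamental theorem of calculus on compact subintervals),
`u(r) → 0` as `r → ∞`, `‖u‖_{L^p_θ} < ∞` and `‖u'‖_{L^p_α} < ∞`. -/
structure MemX (p α θ : ℝ) (u u' : ℝ → ℝ) : Prop where
  ftc_int : ∀ a b : ℝ, 0 < a → a ≤ b → IntervalIntegrable u' MeasureTheory.volume a b
  ftc : ∀ a b : ℝ, 0 < a → a ≤ b → u b - u a = ∫ t in a..b, u' t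
  lim_zero : Filter.Tendsto u Filter.atTop (nhds 0)
  fin_u : wNorm θ p u < ⊤
  fin_u' : wNorm α p u' < ⊤

/-- Full norm on `X`: `‖u‖ = (‖u‖_{L^p_θ}^p + ‖u'‖_{L^p_α}^p)^{1/p}`. -/
noncomputable def Xnorm (p α θ : ℝ) (u u' : ℝ → ℝ) : ℝ≥0∞ :=
  ((wNorm θ p u) ^ p + (wNorm α p u') ^ p) ^ (1 / p)

/-- The truncated exponential `φ_p(t) = Σ_{j ∈ ℕ, j ≥ p-1} t^j / j!`. -/
noncomputable def phiP (p t : ℝ) : ℝ :=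
  ∑' j : ℕ, if p - 1 ≤ (j : ℝ) then t ^ j / (Nat.factorial j : ℝ) else 0

/-- The critical constant `μ_{α,θ} = (θ+1) ω_α^{1/α}`. -/
noncomputable def muC (α θ : ℝ) : ℝ := (θ + 1) * (omegaW α) ^ (1 / α)

/-- The Trudinger–Moser functional `∫₀^∞ φ_p(μ |u|^{p/(p-1)}) dλ_θ`. -/
noncomputable def TMfunc (p θ μ : ℝ) (u : ℝ → ℝ) : ℝ≥0∞ :=
  wInt θ fun r => phiP p (μ * |u r| ^ (p / (p - 1)))

/-- The subcritical Trudinger–Moser supremum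
`TMSC(μ,α,θ) = sup { ‖u‖_{L^p_θ}^{-p} ∫₀^∞ φ_p(μ|u|^{p/(p-1)}) dλ_θ : u ∈ X, u ≠ 0, ‖u'‖_{L^p_α} ≤ 1 }`. -/
noncomputable def TMSC (p α θ μ : ℝ) : ℝ≥0∞ :=
  ⨆ (u : ℝ → ℝ) (u' : ℝ → ℝ) (_ : MemX p α θ u u') (_ : u ≠ 0)
    (_ : wNorm α p u' ≤ 1), (wNorm θ p u) ^ (-p) * TMfunc p θ μ u

/-- The critical Trudinger–Moser supremum
`TMC(σ,α,θ) = sup { ∫₀^∞ φ_p(σ|u|^{p/(p-1)}) dλ_θ : u ∈ X, ‖u‖ ≤ 1 }`. -/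
noncomputable def TMC (p α θ σ : ℝ) : ℝ≥0∞ :=
  ⨆ (u : ℝ → ℝ) (u' : ℝ → ℝ) (_ : MemX p α θ u u') (_ : Xnorm p α θ u u' ≤ 1),
    TMfunc p θ σ u

/-- `k₀ = min { j ∈ ℕ : j ≥ p - 1 }`. -/
noncomputable def k0 (p : ℝ) : ℕ := sInf {j : ℕ | p - 1 ≤ (j : ℝ)}

/-- `TMC(σ,α,θ)` is attained by some `u ∈ X` with `‖u‖ ≤ 1`. -/
def TMCAttained (p α θ σ : ℝ) : Prop :=
  ∃ u u' : ℝ → ℝ, MemX p α θ u u' ∧ Xnorm p α θ u u' ≤ 1 ∧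
    TMC p α θ σ = TMfunc p θ σ u

/-- `σ_* = inf { σ ∈ (0, μ_{α,θ}) : TMC(σ,α,θ) is attained }`. -/
noncomputable def sigmaStar (p α θ : ℝ) : ℝ :=
  sInf {σ : ℝ | σ ∈ Set.Ioo 0 (muC α θ) ∧ TMCAttained p α θ σ}

lemma omegaW_pos {θ : ℝ} (hθ : 0 ≤ θ) : 0 < omegaW θ := by
  have h := Real.Gamma_pos_of_pos (show 0 < (θ + 1) / 2 by linarith)
  unfold omegaW
  positivity

/-! ### The truncated exponential -/

lemma summable_phiP {p t : ℝ} (ht : 0 ≤ t) :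
    Summable fun j : ℕ => if p - 1 ≤ (j : ℝ) then t ^ j / (Nat.factorial j : ℝ) else 0 := by
  refine Summable.of_nonneg_of_le (fun j => ?_) (fun j => ?_) (Real.summable_pow_div_factorial t)
  · split_ifs <;> positivity
  · split_ifs
    · exact le_rfl
    · positivity

lemma phiP_nonneg {p t : ℝ} (ht : 0 ≤ t) : 0 ≤ phiP p t :=
  tsum_nonneg fun j => by split_ifs <;> positivity

lemma phiP_le_exp {p t : ℝ} (ht : 0 ≤ t) : phiP p t ≤ Real.exp t := by
  rw [Real.exp_eq_exp_ℝ, NormedSpace.exp_eq_tsum_div]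
  refine (summable_phiP ht).tsum_le_tsum (fun j => ?_) (Real.summable_pow_div_factorial t)
  split_ifs
  · exact le_rfl
  · positivity

lemma phiP_le_rpow_mul_exp {p s v : ℝ} (hp : 2 ≤ p) (hs : 0 ≤ s) (hv : 0 ≤ v) (hv1 : v ≤ 1) :
    phiP p (s * v ^ (p / (p - 1))) ≤ Real.exp s * v ^ p := by
  rw [Real.exp_eq_exp_ℝ, NormedSpace.exp_eq_tsum_div, ← tsum_mul_right]
  refine (summable_phiP (by positivity)).tsum_le_tsum (fun j => ?_)
    ((Real.summable_pow_div_factorial s).mul_right _)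
  split_ifs with h
  · rw [mul_pow, ← Real.rpow_natCast (v ^ (p / (p - 1))), ← Real.rpow_mul hv, mul_div_right_comm]
    have hpj : p ≤ p / (p - 1) * j := by
      rw [div_mul_eq_mul_div, le_div_iff₀ (by linarith)]
      nlinarith
    refine mul_le_mul_of_nonneg_left ?_ (by positivity)
    exact Real.rpow_le_rpow_of_exponent_ge' hv hv1 (by linarith) hpj
  · positivity

lemma k0_spec (p : ℝ) : p - 1 ≤ (k0 p : ℝ) :=
  Nat.sInf_mem (s := {j : ℕ | p - 1 ≤ (j : ℝ)}) (exists_nat_ge (p - 1))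

lemma k0_le {p : ℝ} {j : ℕ} (h : p - 1 ≤ (j : ℝ)) : k0 p ≤ j := Nat.sInf_le h

lemma mul_pow_le_div_pow_mul {s s₁ t : ℝ} {k j : ℕ} (hs : 0 ≤ s) (hs₁ : 0 < s₁) (hss : s ≤ s₁)
    (ht : 0 ≤ t) (hkj : k ≤ j) :
    (s * t) ^ j / (Nat.factorial j : ℝ) ≤
      (s / s₁) ^ k * ((s₁ * t) ^ j / (Nat.factorial j : ℝ)) := by
  have h : s * t = (s / s₁) * (s₁ * t) := by field_simp
  rw [h, mul_pow, mul_div_assoc]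
  gcongr ?_ * _
  exact pow_le_pow_of_le_one (by positivity) ((div_le_one hs₁).2 hss) hkj

lemma phiP_mul_le {p s s₁ t : ℝ} (hs : 0 ≤ s) (hs₁ : 0 < s₁) (hss : s ≤ s₁) (ht : 0 ≤ t) :
    phiP p (s * t) ≤ (s / s₁) ^ k0 p * phiP p (s₁ * t) := by
  unfold phiP
  rw [← tsum_mul_left]
  refine (summable_phiP (by positivity)).tsum_le_tsum (fun j => ?_)
    ((summable_phiP (by positivity)).mul_left _)
  split_ifs with h
  · exact mul_pow_le_div_pow_mul hs hs₁ hss ht (k0_le h)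
  · simp

lemma phiP_mul_le_add {p s s₁ t : ℝ} (hs : 0 ≤ s) (hs₁ : 0 < s₁) (hss : s ≤ s₁) (ht : 0 ≤ t) :
    phiP p (s * t) ≤ s ^ k0 p / (Nat.factorial (k0 p) : ℝ) * t ^ k0 p +
      (s / s₁) ^ (k0 p + 1) * phiP p (s₁ * t) := by
  have hsum := summable_phiP (p := p) (t := s₁ * t) (by positivity)
  have hsing : Summable fun j : ℕ =>
      if j = k0 p then s ^ k0 p / (Nat.factorial (k0 p) : ℝ) * t ^ k0 p else 0 :=
    (hasSum_ite_eq (k0 p) _).summable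
  unfold phiP
  rw [← tsum_ite_eq (k0 p) (fun _ => s ^ k0 p / (Nat.factorial (k0 p) : ℝ) * t ^ k0 p),
    ← tsum_mul_left, ← hsing.tsum_add (hsum.mul_left _)]
  refine (summable_phiP (by positivity)).tsum_le_tsum (fun j => ?_)
    (hsing.add (hsum.mul_left _))
  by_cases h : p - 1 ≤ (j : ℝ)
  · simp only [h, if_true]
    split_ifs with hj
    · subst hj
      rw [mul_pow, mul_div_right_comm]
      exact le_add_of_nonneg_right (by positivity)
    · rw [zero_add]
      exact mul_pow_le_div_pow_mul hs hs₁ hss ht (lt_of_le_of_ne (k0_le h) (Ne.symm hj))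
  · simp only [h, if_false, mul_zero, add_zero]
    split_ifs <;> positivity

/-! ### The weighted integral -/

lemma wInt_le_mul {θ A : ℝ} {f g : ℝ → ℝ} (hA : 0 ≤ A)
    (hfg : ∀ r, 0 < r → f r ≤ A * g r) : wInt θ f ≤ ENNReal.ofReal A * wInt θ g := by
  unfold wInt
  rw [mul_left_comm, ← lintegral_const_mul' (ENNReal.ofReal A) _ ENNReal.ofReal_ne_top]
  gcongr ENNReal.ofReal (omegaW θ) * ?_
  refine setLIntegral_mono' measurableSet_Ioi fun r hr => ?_
  rw [← mul_assoc, ← ENNReal.ofReal_mul hA]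
  gcongr
  exact hfg r hr

lemma wInt_le_add {θ A B : ℝ} {f g h : ℝ → ℝ} (hA : 0 ≤ A) (hB : 0 ≤ B)
    (hg : AEMeasurable g (volume.restrict (Set.Ioi 0)))
    (hfg : ∀ r, 0 < r → f r ≤ A * g r + B * h r) :
    wInt θ f ≤ ENNReal.ofReal A * wInt θ g + ENNReal.ofReal B * wInt θ h := by
  unfold wInt
  rw [mul_left_comm, mul_left_comm (ENNReal.ofReal B), ← mul_add,
    ← lintegral_const_mul' (ENNReal.ofReal A) _ ENNReal.ofReal_ne_top,
    ← lintegral_const_mul' (ENNReal.ofReal B) _ ENNReal.ofReal_ne_top,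
    ← lintegral_add_left' (by
      exact (hg.ennreal_ofReal.mul (by fun_prop)).const_mul _)]
  gcongr ENNReal.ofReal (omegaW θ) * ?_
  refine setLIntegral_mono' measurableSet_Ioi fun r hr => ?_
  rw [← mul_assoc, ← mul_assoc, ← add_mul, ← ENNReal.ofReal_mul hA, ← ENNReal.ofReal_mul hB]
  gcongr
  exact (ENNReal.ofReal_le_ofReal (hfg r hr)).trans ENNReal.ofReal_add_le

lemma wNorm_rpow_neg {θ p : ℝ} (hp : 0 < p) (u : ℝ → ℝ) :
    (wNorm θ p u) ^ (-p) = (wInt θ fun r => |u r| ^ p)⁻¹ := by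
  rw [wNorm, ← ENNReal.rpow_mul, ← ENNReal.rpow_neg_one]
  congr 1
  field_simp

lemma wNorm_le_one_iff {θ p : ℝ} (hp : 0 < p) (u : ℝ → ℝ) :
    wNorm θ p u ≤ 1 ↔ (wInt θ fun r => |u r| ^ p) ≤ 1 := by
  rw [wNorm, one_div, ENNReal.rpow_inv_le_iff hp, ENNReal.one_rpow]

lemma wNorm_lt_top_iff {θ p : ℝ} (hp : 0 < p) (u : ℝ → ℝ) :
    wNorm θ p u < ⊤ ↔ (wInt θ fun r => |u r| ^ p) < ⊤ := by
  rw [wNorm, ENNReal.rpow_lt_top_iff_of_pos (by positivity)]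

/-! ### Pointwise estimates in the space `X` -/

lemma MemX.continuousOn {p α θ : ℝ} {u u' : ℝ → ℝ} (h : MemX p α θ u u') :
    ContinuousOn u (Set.Ioi 0) := by
  intro x hx
  have hx : 0 < x := hx
  have hint := h.ftc_int (x / 2) (2 * x) (by linarith) (by linarith)
  rw [intervalIntegrable_iff_integrableOn_Icc_of_le (by linarith),
    ← Set.uIcc_of_le (by linarith)] at hint
  have hc := intervalIntegral.continuousOn_primitive_interval hint
  rw [Set.uIcc_of_le (by linarith)] at hc
  have hcx := hc.continuousAt (Icc_mem_nhds (show x / 2 < x by linarith) (by linarith))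
  refine ContinuousAt.continuousWithinAt ?_
  refine (hcx.const_add (u (x / 2))).congr ?_
  filter_upwards [Icc_mem_nhds (show x / 2 < x by linarith) (show x < 2 * x by linarith)]
    with y hy
  rw [← h.ftc (x / 2) y (by linarith) hy.1]
  ring

lemma lintegral_Ioc_inv {a b : ℝ} (ha : 0 < a) (hab : a ≤ b) :
    ∫⁻ t in Set.Ioc a b, ENNReal.ofReal t⁻¹ = ENNReal.ofReal (Real.log (b / a)) := by
  rw [← integral_inv_of_pos ha (ha.trans_le hab), intervalIntegral.integral_of_le hab,
    ofReal_integral_eq_lintegral_ofReal]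
  · refine (intervalIntegrable_iff_integrableOn_Ioc_of_le hab).1 ?_
    refine intervalIntegral.intervalIntegrable_inv (fun x hx => ?_) continuousOn_id
    rw [Set.uIcc_of_le hab] at hx
    exact (ha.trans_le hx.1).ne'
  · filter_upwards [ae_restrict_mem measurableSet_Ioc] with t ht
    exact inv_nonneg.2 (ha.trans ht.1).le

/-- Logarithmic Hölder continuity of functions with `‖u'‖_{L^p_{p-1}} ≤ 1`. -/
lemma MemX.abs_sub_le {p θ : ℝ} {u u' : ℝ → ℝ} (hp : 2 ≤ p) (h : MemX p (p - 1) θ u u')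
    (h1 : wNorm (p - 1) p u' ≤ 1) {a b : ℝ} (ha : 0 < a) (hab : a ≤ b) :
    |u b - u a| ≤ (omegaW (p - 1))⁻¹ ^ (1 / p) * Real.log (b / a) ^ ((p - 1) / p) := by
  have hω : 0 < omegaW (p - 1) := omegaW_pos (by linarith)
  have hlog : 0 ≤ Real.log (b / a) := Real.log_nonneg ((one_le_div ha).2 hab)
  have hconj : p.HolderConjugate (p / (p - 1)) := Real.HolderConjugate.conjExponent (by linarith)
  have hmeas : AEMeasurable u' (volume.restrict (Set.Ioc a b)) :=
    ((intervalIntegrable_iff_integrableOn_Ioc_of_le hab).1 (h.ftc_int a b ha hab)).aemeasurable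
  set f : ℝ → ℝ≥0∞ := fun t => ENNReal.ofReal (|u' t| * t ^ ((p - 1) / p)) with hf
  set g : ℝ → ℝ≥0∞ := fun t => ENNReal.ofReal (t ^ (-((p - 1) / p))) with hg
  have hfm : AEMeasurable f (volume.restrict (Set.Ioc a b)) :=
    (hmeas.abs.mul (by fun_prop)).ennreal_ofReal
  have hgm : AEMeasurable g (volume.restrict (Set.Ioc a b)) := by fun_prop
  have hfp : ∫⁻ t in Set.Ioc a b, f t ^ p ≤ ENNReal.ofReal (omegaW (p - 1))⁻¹ := by
    rw [wNorm_le_one_iff (by linarith), wInt] at h1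
    rw [ENNReal.ofReal_inv_of_pos hω, ← one_div, ENNReal.le_div_iff_mul_le (by simp [hω]) (by simp),
      mul_comm]
    refine le_trans ?_ h1
    gcongr ENNReal.ofReal (omegaW (p - 1)) * ?_
    refine (setLIntegral_mono' measurableSet_Ioc fun t ht => ?_).trans
      (lintegral_mono_set fun t ht => ha.trans ht.1)
    have ht0 : 0 < t := ha.trans ht.1
    rw [hf, ENNReal.ofReal_rpow_of_nonneg (by positivity) (by linarith),
      Real.mul_rpow (by positivity) (by positivity), ← Real.rpow_mul ht0.le,
      div_mul_cancel₀ _ (by linarith), ENNReal.ofReal_mul (by positivity)]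
  have hgq : ∫⁻ t in Set.Ioc a b, g t ^ (p / (p - 1)) = ENNReal.ofReal (Real.log (b / a)) := by
    rw [← lintegral_Ioc_inv ha hab]
    refine setLIntegral_congr_fun measurableSet_Ioc fun t ht => ?_
    have ht0 : 0 < t := ha.trans ht.1
    have hp1 : p - 1 ≠ 0 := by linarith
    have hp0 : p ≠ 0 := by linarith
    simp only [hg]
    rw [ENNReal.ofReal_rpow_of_nonneg (by positivity) (div_nonneg (by linarith) (by linarith)),
      ← Real.rpow_mul ht0.le, ← Real.rpow_neg_one]
    congr 2
    field_simp
  have key : ENNReal.ofReal |u b - u a| ≤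
      ENNReal.ofReal ((omegaW (p - 1))⁻¹ ^ (1 / p) * Real.log (b / a) ^ ((p - 1) / p)) := by
    calc ENNReal.ofReal |u b - u a| = ‖∫ t in Set.Ioc a b, u' t‖ₑ := by
          rw [h.ftc a b ha hab, intervalIntegral.integral_of_le hab, ← Real.norm_eq_abs,
            ofReal_norm]
      _ ≤ ∫⁻ t in Set.Ioc a b, ‖u' t‖ₑ := enorm_integral_le_lintegral_enorm _
      _ = ∫⁻ t in Set.Ioc a b, (f * g) t := by
          refine setLIntegral_congr_fun measurableSet_Ioc fun t ht => ?_
          have ht0 : 0 < t := ha.trans ht.1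
          simp only [Pi.mul_apply, hf, hg]
          rw [← ENNReal.ofReal_mul (by positivity), mul_assoc, ← Real.rpow_add ht0,
            add_neg_cancel, Real.rpow_zero, mul_one, ← Real.norm_eq_abs, ofReal_norm]
      _ ≤ (∫⁻ t in Set.Ioc a b, f t ^ p) ^ (1 / p) *
            (∫⁻ t in Set.Ioc a b, g t ^ (p / (p - 1))) ^ (1 / (p / (p - 1))) :=
          ENNReal.lintegral_mul_le_Lp_mul_Lq _ hconj hfm hgm
      _ ≤ _ := by
          rw [hgq, one_div_div, ENNReal.ofReal_mul (by positivity),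
            ← ENNReal.ofReal_rpow_of_nonneg (by positivity) (by positivity),
            ← ENNReal.ofReal_rpow_of_nonneg hlog (div_nonneg (by linarith) (by linarith))]
          gcongr
  exact (ENNReal.ofReal_le_ofReal_iff (by positivity)).1 key

/-- A function with `‖u'‖_{L^p_{p-1}} ≤ 1` that exceeds `1` at `r` carries `L^p_θ` mass at least
a fixed multiple of `r ^ (θ + 1)`. -/
lemma exists_mass_lower_bound {p θ : ℝ} (hp : 2 ≤ p) (hθ : 0 ≤ θ) :
    ∃ c > 0, ∀ u u' : ℝ → ℝ, MemX p (p - 1) θ u u' → wNorm (p - 1) p u' ≤ 1 →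
      ∀ r, 0 < r → 1 < |u r| → ENNReal.ofReal (c * r ^ (θ + 1)) ≤ wInt θ fun r => |u r| ^ p := by
  have hω : 0 < omegaW (p - 1) := omegaW_pos (by linarith)
  have hωθ := omegaW_pos hθ
  set D : ℝ := (omegaW (p - 1))⁻¹ ^ (1 / p)
  have hD0 : 0 < D := by positivity
  set η : ℝ := (1 / (2 * D)) ^ (p / (p - 1)) with hη
  have hη0 : 0 < η := by positivity
  have hDη : D * η ^ ((p - 1) / p) = 1 / 2 := by
    have hp1 : p - 1 ≠ 0 := by linarith
    have hp0 : p ≠ 0 := by linarith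
    rw [hη, ← Real.rpow_mul (by positivity), show p / (p - 1) * ((p - 1) / p) = 1 by field_simp,
      Real.rpow_one]
    field_simp
  refine ⟨omegaW θ * ((1 / 2) ^ p * η), by positivity, fun u u' h h1 r hr hur => ?_⟩
  have hlow : ∀ t ∈ Set.Ioc r ((1 + η) * r), 1 / 2 ≤ |u t| := by
    intro t ht
    have hle := h.abs_sub_le hp h1 hr ht.1.le
    have htr : t / r ≤ 1 + η := (div_le_iff₀ hr).2 ht.2
    have hlog : Real.log (t / r) ≤ η := by
      have := Real.log_le_sub_one_of_pos (div_pos (hr.trans ht.1) hr)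
      linarith
    have hlog0 : 0 ≤ Real.log (t / r) := Real.log_nonneg ((one_le_div hr).2 ht.1.le)
    have : D * Real.log (t / r) ^ ((p - 1) / p) ≤ 1 / 2 := by
      rw [← hDη]
      have : 0 ≤ (p - 1) / p := div_nonneg (by linarith) (by linarith)
      gcongr
    have habs := abs_sub_abs_le_abs_sub (u r) (u t)
    rw [abs_sub_comm] at habs
    linarith
  have hvol : (volume (Set.Ioc r ((1 + η) * r))) = ENNReal.ofReal (η * r) := by
    rw [Real.volume_Ioc]
    congr 1
    ring
  calc ENNReal.ofReal (omegaW θ * ((1 / 2) ^ p * η) * r ^ (θ + 1))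
      = ENNReal.ofReal (omegaW θ) * ∫⁻ _ in Set.Ioc r ((1 + η) * r),
          ENNReal.ofReal ((1 / 2) ^ p) * ENNReal.ofReal (r ^ θ) := by
        rw [setLIntegral_const, hvol, ← ENNReal.ofReal_mul (by positivity),
          ← ENNReal.ofReal_mul (by positivity), ← ENNReal.ofReal_mul (by positivity),
          Real.rpow_add hr, Real.rpow_one]
        congr 1
        ring
    _ ≤ wInt θ fun r => |u r| ^ p := by
        unfold wInt
        gcongr ENNReal.ofReal (omegaW θ) * ?_
        refine (setLIntegral_mono' measurableSet_Ioc fun t ht => ?_).trans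
          (lintegral_mono_set fun t ht => hr.trans ht.1)
        have htu := hlow t ht
        have htp : (1 / 2 : ℝ) ^ p ≤ |u t| ^ p := by gcongr
        have htr := ht.1.le
        gcongr

lemma lintegral_Ioc_zero_sqrt_mul_rpow_le {θ R : ℝ} (hθ : 0 ≤ θ) (hR : 0 < R) :
    ∫⁻ r in Set.Ioc 0 R, ENNReal.ofReal ((R / r) ^ (1 / 2 : ℝ)) * ENNReal.ofReal (r ^ θ) ≤
      ENNReal.ofReal (2 * R ^ (θ + 1)) := by
  have hint : ∫⁻ r in Set.Ioc 0 R, ENNReal.ofReal (r ^ (-(1 / 2) : ℝ)) =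
      ENNReal.ofReal (2 * R ^ (1 / 2 : ℝ)) := by
    rw [← ofReal_integral_eq_lintegral_ofReal, ← intervalIntegral.integral_of_le hR.le,
      integral_rpow (by norm_num)]
    · congr 1
      norm_num
      ring
    · exact (intervalIntegrable_iff_integrableOn_Ioc_of_le hR.le).1
        (intervalIntegral.intervalIntegrable_rpow' (by norm_num))
    · filter_upwards [ae_restrict_mem measurableSet_Ioc] with t ht
      have := ht.1
      positivity
  calc _ ≤ ∫⁻ r in Set.Ioc 0 R, ENNReal.ofReal (R ^ (1 / 2 : ℝ) * R ^ θ) *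
        ENNReal.ofReal (r ^ (-(1 / 2) : ℝ)) := by
        refine setLIntegral_mono' measurableSet_Ioc fun r hr => ?_
        have hr0 := hr.1
        rw [← ENNReal.ofReal_mul (by positivity), ← ENNReal.ofReal_mul (by positivity)]
        refine ENNReal.ofReal_le_ofReal ?_
        rw [Real.div_rpow hR.le hr0.le, Real.rpow_neg hr0.le, div_eq_mul_inv, mul_right_comm]
        have := hr.2
        gcongr
    _ = ENNReal.ofReal (2 * R ^ (θ + 1)) := by
        rw [lintegral_const_mul' _ _ ENNReal.ofReal_ne_top, hint,
          ← ENNReal.ofReal_mul (by positivity)]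
        congr 1
        rw [Real.rpow_add hR, Real.rpow_one]
        have : R ^ (1 / 2 : ℝ) * R ^ (1 / 2 : ℝ) = R := by
          rw [← Real.rpow_add hR]
          norm_num
        linear_combination 2 * R ^ θ * this

/-- A subcritical Trudinger–Moser inequality for some (small) exponent. -/
lemma exists_TMfunc_le {p θ : ℝ} (hp : 2 ≤ p) (hθ : 0 ≤ θ) :
    ∃ s > 0, ∃ K : ℝ, ∀ u u' : ℝ → ℝ, MemX p (p - 1) θ u u' → wNorm (p - 1) p u' ≤ 1 →
      TMfunc p θ s u ≤ ENNReal.ofReal K * wInt θ fun r => |u r| ^ p := by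
  obtain ⟨c, hc, hmass⟩ := exists_mass_lower_bound hp hθ
  have hω : 0 < omegaW (p - 1) := omegaW_pos (by linarith)
  have hωθ := omegaW_pos hθ
  set D : ℝ := (omegaW (p - 1))⁻¹ ^ (1 / p)
  have hD0 : 0 < D := by positivity
  set q : ℝ := p / (p - 1) with hq
  have hq0 : 0 < q := div_pos (by linarith) (by linarith)
  set s : ℝ := 1 / (2 * (2 ^ q * D ^ q)) with hs
  have hs0 : 0 < s := by positivity
  set E : ℝ := Real.exp (s * 2 ^ q)
  have hE0 : 0 < E := Real.exp_pos _
  refine ⟨s, hs0, omegaW θ * (E * (2 * (2 / c))) + Real.exp s, fun u u' h h1 => ?_⟩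
  have hNtop := (wNorm_lt_top_iff (θ := θ) (by linarith : 0 < p) u).1 h.fin_u
  set N : ℝ≥0∞ := wInt θ fun r => |u r| ^ p with hN
  set R : ℝ := (2 / c * N.toReal) ^ (1 / (θ + 1)) with hR
  have hR0 : 0 ≤ R := by positivity
  have hRpow : R ^ (θ + 1) = 2 / c * N.toReal := by
    rw [hR, ← Real.rpow_mul (by positivity), one_div_mul_cancel (by linarith), Real.rpow_one]
  have hsmall : ∀ r, 0 < r → R ≤ r → |u r| ≤ 1 := by
    intro r hr hRr
    by_contra! hlt
    have hm := hmass u u' h h1 r hr hlt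
    rw [ENNReal.ofReal_le_iff_le_toReal hNtop.ne] at hm
    have h2 : R ^ (θ + 1) ≤ r ^ (θ + 1) := by gcongr
    rw [hRpow] at h2
    have h3 : c * (2 / c * N.toReal) = 2 * N.toReal := by field_simp
    have h4 : 0 < c * r ^ (θ + 1) := by positivity
    nlinarith [mul_le_mul_of_nonneg_left h2 hc.le]
  have hbig : ∀ r, 0 < r → r ≤ R →
      phiP p (s * |u r| ^ q) ≤ E * (R / r) ^ (1 / 2 : ℝ) := by
    intro r hr hrR
    have hRpos := hr.trans_le hrR
    have hL : 0 ≤ Real.log (R / r) := Real.log_nonneg ((one_le_div hr).2 hrR)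
    have hdiff := h.abs_sub_le hp h1 hr hrR
    have hpq : (p - 1) / p * q = 1 := by
      have hp1 : p - 1 ≠ 0 := by linarith
      have hp0 : p ≠ 0 := by linarith
      rw [hq]
      field_simp
    set x : ℝ := D * Real.log (R / r) ^ ((p - 1) / p) with hx
    have hx0 : 0 ≤ x := by positivity
    have hxq : x ^ q = D ^ q * Real.log (R / r) := by
      rw [hx, Real.mul_rpow hD0.le (by positivity), ← Real.rpow_mul hL, hpq, Real.rpow_one]
    have hux : |u r| ≤ 1 + x := by
      have := abs_sub_abs_le_abs_sub (u r) (u R)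
      rw [abs_sub_comm] at this
      linarith [hsmall R hRpos le_rfl]
    have huq : |u r| ^ q ≤ 2 ^ q * (1 + x ^ q) := by
      calc |u r| ^ q ≤ (2 * max 1 x) ^ q := by
            gcongr
            linarith [le_max_left 1 x, le_max_right 1 x]
        _ = 2 ^ q * (max 1 x) ^ q := Real.mul_rpow (by norm_num) (by positivity)
        _ ≤ 2 ^ q * (1 + x ^ q) := by
            gcongr
            rcases le_total 1 x with hx1 | hx1
            · rw [max_eq_right hx1]
              linarith
            · rw [max_eq_left hx1, Real.one_rpow]
              linarith [Real.rpow_nonneg hx0 q]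
    have hexp : s * |u r| ^ q ≤ s * 2 ^ q + Real.log (R / r) * (1 / 2) := by
      calc s * |u r| ^ q ≤ s * (2 ^ q * (1 + x ^ q)) := by gcongr
        _ = s * 2 ^ q + Real.log (R / r) * (1 / 2) := by
            rw [hxq, mul_add, mul_add, mul_one, hs]
            congr 1
            field_simp
    calc phiP p (s * |u r| ^ q) ≤ Real.exp (s * |u r| ^ q) := phiP_le_exp (by positivity)
      _ ≤ Real.exp (s * 2 ^ q + Real.log (R / r) * (1 / 2)) := Real.exp_le_exp.2 hexp
      _ = E * (R / r) ^ (1 / 2 : ℝ) := by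
          rw [Real.exp_add, Real.rpow_def_of_pos (show 0 < R / r by positivity)]
  have hin : ∫⁻ r in Set.Ioc 0 R, ENNReal.ofReal (phiP p (s * |u r| ^ q)) *
      ENNReal.ofReal (r ^ θ) ≤ ENNReal.ofReal (E * (2 * R ^ (θ + 1))) := by
    rcases hR0.eq_or_lt with hRz | hRpos
    · simp [← hRz]
    calc _ ≤ ∫⁻ r in Set.Ioc 0 R, ENNReal.ofReal E *
          (ENNReal.ofReal ((R / r) ^ (1 / 2 : ℝ)) * ENNReal.ofReal (r ^ θ)) := by
          refine setLIntegral_mono' measurableSet_Ioc fun r hr => ?_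
          rw [← mul_assoc, ← ENNReal.ofReal_mul hE0.le]
          gcongr
          exact hbig r hr.1 hr.2
      _ ≤ _ := by
          rw [lintegral_const_mul' _ _ ENNReal.ofReal_ne_top, ENNReal.ofReal_mul (by positivity)]
          gcongr
          exact lintegral_Ioc_zero_sqrt_mul_rpow_le hθ hRpos
  have hout : ∫⁻ r in Set.Ioi R, ENNReal.ofReal (phiP p (s * |u r| ^ q)) *
      ENNReal.ofReal (r ^ θ) ≤ ENNReal.ofReal (Real.exp s) *
        ∫⁻ r in Set.Ioi 0, ENNReal.ofReal (|u r| ^ p) * ENNReal.ofReal (r ^ θ) := by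
    rw [← lintegral_const_mul' _ _ ENNReal.ofReal_ne_top]
    refine (setLIntegral_mono' measurableSet_Ioi fun r hr => ?_).trans
      (lintegral_mono_set (Set.Ioi_subset_Ioi hR0))
    rw [← mul_assoc, ← ENNReal.ofReal_mul (Real.exp_pos s).le]
    gcongr
    exact phiP_le_rpow_mul_exp hp hs0.le (abs_nonneg _) (hsmall r (hR0.trans_lt hr) (le_of_lt hr))
  calc TMfunc p θ s u
      ≤ ENNReal.ofReal (omegaW θ) * (ENNReal.ofReal (E * (2 * R ^ (θ + 1))) +
          ENNReal.ofReal (Real.exp s) *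
            ∫⁻ r in Set.Ioi 0, ENNReal.ofReal (|u r| ^ p) * ENNReal.ofReal (r ^ θ)) := by
        unfold TMfunc wInt
        rw [← Set.Ioc_union_Ioi_eq_Ioi hR0]
        gcongr ENNReal.ofReal (omegaW θ) * ?_
        refine (lintegral_union_le _ _ _).trans (add_le_add hin ?_)
        rwa [Set.Ioc_union_Ioi_eq_Ioi hR0]
    _ = ENNReal.ofReal (omegaW θ * (E * (2 * (2 / c))) + Real.exp s) * N := by
        rw [mul_add, mul_left_comm _ (ENNReal.ofReal (Real.exp s)), hRpow,
          ENNReal.ofReal_add (by positivity) (by positivity), add_mul,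
          ← ENNReal.ofReal_mul hωθ.le]
        congr 1
        conv_rhs => rw [← ENNReal.ofReal_toReal hNtop.ne]
        rw [← ENNReal.ofReal_mul (by positivity)]
        congr 1
        ring

/-! ### Behaviour of the subcritical supremum for small parameters -/

lemma exists_TMSC_lt_top {p θ : ℝ} (hp : 2 ≤ p) (hθ : 0 ≤ θ) :
    ∃ s > 0, TMSC p (p - 1) θ s < ⊤ := by
  obtain ⟨s, hs, K, hK⟩ := exists_TMfunc_le hp hθ
  refine ⟨s, hs, lt_of_le_of_lt ?_ (ENNReal.ofReal_lt_top (r := K))⟩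
  refine iSup_le fun u => iSup_le fun u' => iSup_le fun h => iSup_le fun _ => iSup_le fun h1 => ?_
  rw [wNorm_rpow_neg (by linarith)]
  calc _ ≤ (wInt θ fun r => |u r| ^ p)⁻¹ * (ENNReal.ofReal K * wInt θ fun r => |u r| ^ p) := by
        gcongr
        exact hK u u' h h1
    _ = ENNReal.ofReal K * ((wInt θ fun r => |u r| ^ p)⁻¹ * wInt θ fun r => |u r| ^ p) := by
        ring
    _ ≤ ENNReal.ofReal K * 1 := by
        gcongr
        exact ENNReal.inv_mul_le_one _
    _ = _ := mul_one _

lemma le_TMSC {p α θ s : ℝ} {u u' : ℝ → ℝ} (h : MemX p α θ u u') (hu : u ≠ 0)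
    (h1 : wNorm α p u' ≤ 1) : (wNorm θ p u) ^ (-p) * TMfunc p θ s u ≤ TMSC p α θ s :=
  le_iSup_of_le u <| le_iSup_of_le u' <| le_iSup_of_le h <| le_iSup_of_le hu <|
    le_iSup_of_le h1 le_rfl

lemma TMSC_le_pow_mul {p α θ s s₁ : ℝ} (hs : 0 ≤ s) (hs₁ : 0 < s₁) (hss : s ≤ s₁) :
    TMSC p α θ s ≤ ENNReal.ofReal ((s / s₁) ^ k0 p) * TMSC p α θ s₁ := by
  refine iSup_le fun u => iSup_le fun u' => iSup_le fun h => iSup_le fun hu => iSup_le fun h1 => ?_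
  calc _ ≤ (wNorm θ p u) ^ (-p) * (ENNReal.ofReal ((s / s₁) ^ k0 p) * TMfunc p θ s₁ u) := by
        gcongr
        exact wInt_le_mul (by positivity) fun r _ => phiP_mul_le hs hs₁ hss (by positivity)
    _ = ENNReal.ofReal ((s / s₁) ^ k0 p) * ((wNorm θ p u) ^ (-p) * TMfunc p θ s₁ u) := by ring
    _ ≤ _ := by
        gcongr
        exact le_TMSC h hu h1

lemma TMSC_le_add {p α θ s s₁ : ℝ} (hp : 2 ≤ p) (hk : (k0 p : ℝ) = p - 1) (hs : 0 ≤ s)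
    (hs₁ : 0 < s₁) (hss : s ≤ s₁) :
    TMSC p α θ s ≤ ENNReal.ofReal (s ^ k0 p / (Nat.factorial (k0 p) : ℝ)) +
      ENNReal.ofReal ((s / s₁) ^ (k0 p + 1)) * TMSC p α θ s₁ := by
  refine iSup_le fun u => iSup_le fun u' => iSup_le fun h => iSup_le fun hu => iSup_le fun h1 => ?_
  have hbound : TMfunc p θ s u ≤
      ENNReal.ofReal (s ^ k0 p / (Nat.factorial (k0 p) : ℝ)) * (wInt θ fun r => |u r| ^ p) +
        ENNReal.ofReal ((s / s₁) ^ (k0 p + 1)) * TMfunc p θ s₁ u := by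
    refine wInt_le_add (by positivity) (by positivity) ?_ fun r _ => ?_
    · exact (h.continuousOn.aemeasurable measurableSet_Ioi).abs.pow_const p
    · have hpow : (|u r| ^ (p / (p - 1))) ^ k0 p = |u r| ^ p := by
        rw [← Real.rpow_natCast, ← Real.rpow_mul (abs_nonneg _), hk,
          div_mul_cancel₀ _ (by linarith)]
      rw [← hpow]
      exact phiP_mul_le_add hs hs₁ hss (by positivity)
  have hN := wNorm_rpow_neg (θ := θ) (by linarith : 0 < p) u
  calc (wNorm θ p u) ^ (-p) * TMfunc p θ s u
      ≤ (wNorm θ p u) ^ (-p) *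
        (ENNReal.ofReal (s ^ k0 p / (Nat.factorial (k0 p) : ℝ)) * (wInt θ fun r => |u r| ^ p) +
          ENNReal.ofReal ((s / s₁) ^ (k0 p + 1)) * TMfunc p θ s₁ u) := by gcongr
    _ = ENNReal.ofReal (s ^ k0 p / (Nat.factorial (k0 p) : ℝ)) *
          ((wInt θ fun r => |u r| ^ p)⁻¹ * wInt θ fun r => |u r| ^ p) +
        ENNReal.ofReal ((s / s₁) ^ (k0 p + 1)) *
          ((wNorm θ p u) ^ (-p) * TMfunc p θ s₁ u) := by
        rw [← hN]
        ring
    _ ≤ ENNReal.ofReal (s ^ k0 p / (Nat.factorial (k0 p) : ℝ)) * 1 +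
        ENNReal.ofReal ((s / s₁) ^ (k0 p + 1)) * TMSC p α θ s₁ := by
        gcongr
        · exact ENNReal.inv_mul_le_one _
        · exact le_TMSC h hu h1
    _ = _ := by rw [mul_one]

lemma one_sub_div_le_div {p s σ : ℝ} (hs : 0 < s) (hσ : 0 < σ) :
    (1 - (s / σ) ^ (p - 1)) / (s / σ) ^ (p - 1) ≤ σ ^ (p - 1) * s ^ (-(p - 1)) := by
  have h1 : σ ^ (p - 1) * s ^ (-(p - 1)) = 1 / (s / σ) ^ (p - 1) := by
    rw [Real.rpow_neg hs.le, Real.div_rpow hs.le hσ.le, one_div_div, div_eq_mul_inv]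
  rw [h1]
  gcongr
  linarith [Real.rpow_pos_of_pos (div_pos hs hσ) (p - 1)]

theorem stmt_17 (p α θ σ : ℝ) (hp : 2 ≤ p) (hα : α = p - 1) (hθ : 0 ≤ θ)
    (hσ : 0 < σ) (hσ' : σ < muC α θ) :
    ((p - 1 < (k0 p : ℝ)) →
      Filter.limsup (fun s : ℝ =>
          ENNReal.ofReal ((1 - (s / σ) ^ (p - 1)) / (s / σ) ^ (p - 1)) * TMSC p α θ s)
        (nhdsWithin 0 (Set.Ioi 0)) = 0) ∧
    (((k0 p : ℝ) = p - 1) →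
      Filter.limsup (fun s : ℝ =>
          ENNReal.ofReal ((1 - (s / σ) ^ (p - 1)) / (s / σ) ^ (p - 1)) * TMSC p α θ s)
        (nhdsWithin 0 (Set.Ioi 0)) ≤
        ENNReal.ofReal (σ ^ (k0 p) / (Nat.factorial (k0 p) : ℝ))) := by
  subst hα
  obtain ⟨s₁, hs₁, hT⟩ := exists_TMSC_lt_top hp hθ
  set T := TMSC p (p - 1) θ s₁
  set k := k0 p
  have hev : ∀ᶠ s in nhdsWithin (0 : ℝ) (Set.Ioi 0), 0 < s ∧ s ≤ s₁ := by
    filter_upwards [Ioc_mem_nhdsGT hs₁] with s hs using hs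
  have hlim : ∀ C e : ℝ, 0 < e →
      Tendsto (fun s : ℝ => ENNReal.ofReal (C * s ^ e) * T) (nhdsWithin 0 (Set.Ioi 0))
        (nhds 0) := by
    intro C e he
    have h1 : Tendsto (fun s : ℝ => C * s ^ e) (nhdsWithin 0 (Set.Ioi 0)) (nhds 0) := by
      have := ((Real.continuousAt_rpow_const 0 e (Or.inr he.le)).tendsto.const_mul C).mono_left
        (nhdsWithin_le_nhds (s := Set.Ioi 0))
      simpa [Real.zero_rpow he.ne'] using this
    have h2 := ENNReal.Tendsto.mul_const (ENNReal.tendsto_ofReal h1) (Or.inr hT.ne)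
    simpa using h2
  refine ⟨fun hk => ?_, fun hk => ?_⟩
  · refine le_antisymm ?_ bot_le
    refine le_of_le_of_eq ?_
      (hlim (σ ^ (p - 1) * s₁⁻¹ ^ k) (k - (p - 1)) (by linarith)).limsup_eq
    refine limsup_le_limsup ?_
    filter_upwards [hev] with s hs
    have hs0 := hs.1
    calc _ ≤ ENNReal.ofReal (σ ^ (p - 1) * s ^ (-(p - 1))) *
          (ENNReal.ofReal ((s / s₁) ^ k) * T) := by
          gcongr
          · exact one_sub_div_le_div hs.1 hσ
          · exact TMSC_le_pow_mul hs.1.le hs₁ hs.2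
      _ = _ := by
          rw [← mul_assoc, ← ENNReal.ofReal_mul (by positivity)]
          congr 2
          rw [sub_eq_add_neg (k : ℝ), Real.rpow_add hs.1, Real.rpow_natCast, div_eq_mul_inv,
            mul_pow]
          ring
  · set A := ENNReal.ofReal (σ ^ k / (Nat.factorial k : ℝ)) with hA
    have hl := (hlim (σ ^ k * s₁⁻¹ ^ (k + 1)) 1 one_pos).const_add A
    rw [add_zero] at hl
    refine le_of_le_of_eq ?_ hl.limsup_eq
    refine limsup_le_limsup ?_
    filter_upwards [hev] with s hs
    have hs0 := hs.1
    calc _ ≤ ENNReal.ofReal (σ ^ (p - 1) * s ^ (-(p - 1))) *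
          (ENNReal.ofReal (s ^ k / (Nat.factorial k : ℝ)) +
            ENNReal.ofReal ((s / s₁) ^ (k + 1)) * T) := by
          gcongr
          · exact one_sub_div_le_div hs.1 hσ
          · exact TMSC_le_add hp hk hs.1.le hs₁ hs.2
      _ = _ := by
          rw [mul_add, ← mul_assoc, ← ENNReal.ofReal_mul (by positivity),
            ← ENNReal.ofReal_mul (by positivity), hA, ← hk, Real.rpow_neg hs.1.le,
            Real.rpow_natCast, Real.rpow_natCast, Real.rpow_one]
          have hsk : s ^ k ≠ 0 := (pow_pos hs0 k).ne'
          congr 1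
          · congr 1
            field_simp
          · congr 2
            rw [div_pow, inv_pow, pow_succ s]
            field_simp
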